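/- Let A_1A_2A_3 and B_1B_2B_3 be two triangles in a plane π of projective 3-space, in perspective from a point V, sharing no vertex and no side. Choose a point W not in π, and a point A_2* on line WA_2 distinct from W and A_2; let B_2* be the intersection of lines VA_2* and WB_2. Then the triangles A_1A_2*A_3 and B_1B_2*B_3 are in perspective from V and are not coplanar, and projection from W maps the line of intersections of their corresponding sides onto the line in π containing the three intersection points of corresponding sides of the original triangles. -/

import Mathlib

open scoped LinearAlgebra.Projectivization
open Projectivization

/-- The linear span of a set of points of a projective space, as a submodule
of the underlying vector space. -/
noncomputable def pspan (K : Type*) {V : Type*} [DivisionRing K] [AddCommGroup V] [Module K V]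
    (s : Set (ℙ K V)) : Submodule K V :=
  ⨆ P ∈ s, Projectivization.submodule P

lemma pt_le_iff {K E : Type*} [Field K] [AddCommGroup E] [Module K E]
    (P : ℙ K E) (S : Submodule K E) : P.submodule ≤ S ↔ P.rep ∈ S := by
  rw [Projectivization.submodule_eq, Submodule.span_singleton_le_iff_mem]

lemma pspan_pair' {K E : Type*} [Field K] [AddCommGroup E] [Module K E]
    {P Q : ℙ K E} {p q : E} (hp : P.submodule = Submodule.span K {p})
    (hq : Q.submodule = Submodule.span K {q}) :
    pspan K {P, Q} = Submodule.span K {p, q} := by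
  unfold pspan
  rw [iSup_pair, hp, hq, ← Submodule.span_union, Set.singleton_union]

lemma pspan_range' {K E ι : Type*} [Field K] [AddCommGroup E] [Module K E]
    {P : ι → ℙ K E} {p : ι → E} (hp : ∀ i, (P i).submodule = Submodule.span K {p i}) :
    pspan K (Set.range P) = Submodule.span K (Set.range p) := by
  unfold pspan
  rw [iSup_range, Submodule.span_range_eq_iSup]
  exact iSup_congr hp

lemma pspan_union' {K E : Type*} [Field K] [AddCommGroup E] [Module K E]
    (s t : Set (ℙ K E)) : pspan K (s ∪ t) = pspan K s ⊔ pspan K t := by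
  unfold pspan
  exact iSup_union

lemma rep_ne_smul {K E : Type*} [Field K] [AddCommGroup E] [Module K E]
    {P Q : ℙ K E} (h : P ≠ Q) (c : K) : P.rep ≠ c • Q.rep := by
  intro e
  apply h
  rw [← P.mk_rep, ← Q.mk_rep, Projectivization.mk_eq_mk_iff']
  exact ⟨c, e.symm⟩

lemma sub_eq_of_smul {K E : Type*} [Field K] [AddCommGroup E] [Module K E]
    {P : ℙ K E} {c : K} {x : E} (hc : c ≠ 0) (h : P.rep = c • x) :
    P.submodule = Submodule.span K {x} := by
  rw [Projectivization.submodule_eq, h, Submodule.span_singleton_smul_eq (IsUnit.mk0 c hc)]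

lemma mem_span_three {K E : Type*} [Field K] [AddCommGroup E] [Module K E]
    {p : Fin 3 → E} {x : E} : x ∈ Submodule.span K (Set.range p) ↔
      ∃ c0 c1 c2 : K, x = c0 • p 0 + c1 • p 1 + c2 • p 2 := by
  rw [Submodule.mem_span_range_iff_exists_fun]
  constructor
  · rintro ⟨c, rfl⟩
    exact ⟨c 0, c 1, c 2, by rw [Fin.sum_univ_three]⟩
  · rintro ⟨c0, c1, c2, rfl⟩
    exact ⟨![c0, c1, c2], by rw [Fin.sum_univ_three]; rfl⟩

/-- Coordinates adapted to a triangle of a plane and a point outside it. -/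
lemma exists_coords {K : Type*} [Field K]
    (π : Submodule K (Fin 4 → K)) (hπ : Module.finrank K π = 3)
    (a : Fin 3 → (Fin 4 → K)) (ha : Submodule.span K (Set.range a) = π)
    (w : Fin 4 → K) (hw : w ∉ π) :
    ∃ (φ : (Fin 4 → K) →ₗ[K] K) (α : Fin 3 → ((Fin 4 → K) →ₗ[K] K)),
      (∀ x, x = φ x • w + (α 0 x • a 0 + α 1 x • a 1 + α 2 x • a 2)) ∧
      φ w = 1 ∧ (∀ i, α i w = 0) ∧ (∀ i, φ (a i) = 0) ∧
      (∀ i j, α i (a j) = if i = j then 1 else 0) ∧ (∀ x, x ∈ π ↔ φ x = 0) := by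
  have hli : LinearIndependent K a := by
    rw [linearIndependent_iff_card_eq_finrank_span, Set.finrank, ha, hπ]; rfl
  have hli4 : LinearIndependent K (Fin.cons w a : Fin 4 → (Fin 4 → K)) := by
    rw [linearIndependent_finCons, ha]; exact ⟨hli, hw⟩
  let e := basisOfLinearIndependentOfCardEqFinrank hli4 (by simp)
  have he : ∀ i, e i = (Fin.cons w a : Fin 4 → (Fin 4 → K)) i := fun i => by simp [e]
  have h0 : w = e 0 := by rw [he]; rfl
  have hs : ∀ i, a i = e (Fin.succ i) := fun i => by rw [he]; rfl
  have hx : ∀ x, x = e.coord 0 x • w + (e.coord 1 x • a 0 + e.coord 2 x • a 1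
      + e.coord 3 x • a 2) := by
    intro x
    conv_lhs => rw [← e.sum_repr x]
    rw [Fin.sum_univ_four, h0, hs, hs, hs]
    simp [add_assoc]
  have hφa : ∀ i, e.coord 0 (a i) = 0 := by
    intro i; rw [hs]; simp [Finsupp.single_apply]
  refine ⟨e.coord 0, fun i => e.coord (Fin.succ i), hx, ?_, ?_, hφa, ?_, ?_⟩
  · rw [h0]; simp
  · intro i; rw [h0]; simp [Finsupp.single_apply, (Fin.succ_ne_zero i).symm]
  · intro i j; rw [hs]; simp [Finsupp.single_apply, eq_comm]
  · intro x
    rw [← ha, mem_span_three]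
    constructor
    · rintro ⟨c0, c1, c2, rfl⟩
      simp only [map_add, map_smul, hφa]; simp
    · intro h
      refine ⟨e.coord 1 x, e.coord 2 x, e.coord 3 x, ?_⟩
      conv_lhs => rw [hx x, h, zero_smul, zero_add]

/-- If two lines `p q` and `r s` both contain independent vectors they agree;
here: two vectors in a distinct intersection are proportional. -/
lemma inter_prop {K E : Type*} [Field K] [AddCommGroup E] [Module K E]
    {p q r s x y : E}
    (hne : Submodule.span K {p, q} ≠ Submodule.span K {r, s})
    (hx : x ∈ Submodule.span K {p, q}) (hx' : x ∈ Submodule.span K {r, s})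
    (hy : y ∈ Submodule.span K {p, q}) (hy' : y ∈ Submodule.span K {r, s})
    (hy0 : y ≠ 0) : ∃ c : K, x = c • y := by
  by_contra! hcon
  have hli : LinearIndependent K ![y, x] := by
    rw [LinearIndependent.pair_iff' hy0]
    exact fun c h => hcon c h.symm
  have h2 : Module.finrank K (Submodule.span K {y, x}) = 2 := by
    have := finrank_span_eq_card hli
    rw [Matrix.range_cons_cons_empty] at this
    simpa using this
  have key : ∀ u v : E, x ∈ Submodule.span K {u, v} → y ∈ Submodule.span K {u, v} →
      Submodule.span K {y, x} = Submodule.span K {u, v} := by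
    intro u v h h'
    have : FiniteDimensional K (Submodule.span K {u, v}) :=
      FiniteDimensional.span_of_finite K (by simp)
    apply Submodule.eq_of_le_of_finrank_le
    · rw [Submodule.span_le]; rintro z (rfl | rfl) <;> assumption
    · rw [h2]
      classical
      have := finrank_span_finset_le_card (R := K) ({u, v} : Finset E)
      rw [Finset.coe_pair] at this
      exact this.trans Finset.card_le_two
  exact hne ((key p q hx hy).symm.trans (key r s hx' hy'))

/-- Lifting proof of the planar Desargues theorem: given triangles `A`, `B` in
a plane `π` of projective 3-space, in perspective from `V`, sharing no vertex
and no side, a point `W ∉ π`, a point `A₂* ∈ WA₂ \ {W, A₂}`, and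
`B₂* = VA₂* ∩ WB₂`, the lifted triangles `A₁A₂*A₃` and `B₁B₂*B₃` are in
perspective from `V` and not coplanar, and projection from `W` maps the line
of intersections of their corresponding sides onto the line in `π` containing
the three intersection points of corresponding sides of `A`, `B`. -/
theorem desargues_lifting {K : Type*} [Field K]
    (π : Submodule K (Fin 4 → K)) (hπ : Module.finrank K π = 3)
    (A B : Fin 3 → ℙ K (Fin 4 → K)) (V W A₂s B₂s : ℙ K (Fin 4 → K))
    -- `A`, `B` are triangles of the plane `π`
    (hAπ : ∀ i, (A i).submodule ≤ π) (hBπ : ∀ i, (B i).submodule ≤ π)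
    (hA : pspan K (Set.range A) = π) (hB : pspan K (Set.range B) = π)
    -- in perspective from `V`
    (hV : ∀ i : Fin 3, V.submodule ≤ pspan K {A i, B i})
    -- no common vertex, no common side
    (hvert : ∀ i j : Fin 3, A i ≠ B j)
    (hside : ∀ i j r s : Fin 3, i ≠ j → r ≠ s →
      pspan K {A i, A j} ≠ pspan K {B r, B s})
    -- `W` is a point outside `π`
    (hW : ¬ W.submodule ≤ π)
    -- `A₂*` lies on line `WA₂`, distinct from `W` and `A₂`
    (hA₂s : A₂s.submodule ≤ pspan K {W, A 1}) (hA₂sW : A₂s ≠ W)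
    (hA₂sA : A₂s ≠ A 1)
    -- `B₂*` is the intersection of lines `VA₂*` and `WB₂`
    (hB₂s : B₂s.submodule ≤ pspan K {V, A₂s} ∧
            B₂s.submodule ≤ pspan K {W, B 1}) :
    -- the lifted triangles are in perspective from `V`
    (∀ i : Fin 3, V.submodule ≤
      pspan K {Function.update A 1 A₂s i, Function.update B 1 B₂s i}) ∧
    -- the lifted triangles are not coplanar
    (pspan K (Set.range (Function.update A 1 A₂s) ∪
              Set.range (Function.update B 1 B₂s)) = ⊤) ∧
    -- projection from `W` maps the line of intersection `l*` of the planes of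
    -- the lifted triangles onto a line `l` of `π` containing all intersection
    -- points of corresponding sides of `A`, `B`
    (∃ l : Submodule K (Fin 4 → K), Module.finrank K l = 2 ∧ l ≤ π ∧
      (∀ i j : Fin 3, i ≠ j → ∀ P : ℙ K (Fin 4 → K),
        P.submodule ≤ pspan K {A i, A j} → P.submodule ≤ pspan K {B i, B j} →
        P.submodule ≤ l) ∧
      (∀ Q : ℙ K (Fin 4 → K),
        Q.submodule ≤ pspan K (Set.range (Function.update A 1 A₂s)) ⊓
                      pspan K (Set.range (Function.update B 1 B₂s)) →
        ∀ Q' : ℙ K (Fin 4 → K),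
          Q'.submodule ≤ pspan K {W, Q} → Q'.submodule ≤ π →
          Q'.submodule ≤ l) ∧
      (∀ Q' : ℙ K (Fin 4 → K), Q'.submodule ≤ l →
        ∃ Q : ℙ K (Fin 4 → K),
          Q.submodule ≤ pspan K (Set.range (Function.update A 1 A₂s)) ⊓
                        pspan K (Set.range (Function.update B 1 B₂s)) ∧
          Q'.submodule ≤ pspan K {W, Q})) := by
  have hrep : ∀ P : ℙ K (Fin 4 → K), P.submodule = Submodule.span K {P.rep} :=
    fun P => Projectivization.submodule_eq P
  -- vectors
  obtain ⟨a, ha⟩ : ∃ a : Fin 3 → (Fin 4 → K), ∀ i, (A i).rep = a i := ⟨_, fun _ => rfl⟩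
  obtain ⟨b, hb⟩ : ∃ b : Fin 3 → (Fin 4 → K), ∀ i, (B i).rep = b i := ⟨_, fun _ => rfl⟩
  have hAs : ∀ i, (A i).submodule = Submodule.span K {a i} := fun i => by rw [hrep, ha]
  have hBs : ∀ i, (B i).submodule = Submodule.span K {b i} := fun i => by rw [hrep, hb]
  -- the lifted vertex `A₂*`
  obtain ⟨w, hWs, hAst⟩ : ∃ w, W.submodule = Submodule.span K {w} ∧
      A₂s.submodule = Submodule.span K {a 1 + w} := by
    rw [pt_le_iff, pspan_pair' (hrep W) (hAs 1), Submodule.mem_span_pair] at hA₂s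
    obtain ⟨t, c, h⟩ := hA₂s
    have ht : t ≠ 0 := by
      rintro rfl
      apply rep_ne_smul hA₂sA c
      rw [← h, ha]; simp
    have hc : c ≠ 0 := by
      rintro rfl
      apply rep_ne_smul hA₂sW t
      rw [← h]; simp
    refine ⟨(t / c) • W.rep, ?_, ?_⟩
    · apply sub_eq_of_smul (c := c / t) (div_ne_zero hc ht)
      rw [smul_smul, div_mul_div_cancel₀ ht, div_self hc, one_smul]
    · apply sub_eq_of_smul hc
      rw [← h, smul_add, smul_smul, mul_div_cancel₀ _ hc, add_comm]
  have hwπ : w ∉ π := by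
    rwa [hWs, Submodule.span_singleton_le_iff_mem] at hW
  rw [pspan_range' hAs] at hA
  rw [pspan_range' hBs] at hB
  obtain ⟨φ, α, hαx, hφw, hαw, hφa, hαa, hφπ⟩ := exists_coords π hπ a hA w hwπ
  obtain ⟨φ', β, hβx, hφ'w, hβw, hφ'b, hβb, hφ'π⟩ := exists_coords π hπ b hB w hwπ
  have hφφ : φ' = φ := by
    refine LinearMap.ext fun x => ?_
    have h1 : x - φ x • w ∈ π := by rw [hφπ]; simp [hφw]
    rw [hφ'π] at h1
    simp only [map_sub, map_smul, hφ'w, smul_eq_mul, mul_one] at h1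
    exact sub_eq_zero.mp h1
  subst hφφ
  -- perspectivity
  have hV' : ∀ i, ∃ x y : K, V.rep = x • a i + y • b i := by
    intro i
    have := hV i
    rw [pt_le_iff, pspan_pair' (hAs i) (hBs i), Submodule.mem_span_pair] at this
    obtain ⟨x, y, h⟩ := this
    exact ⟨x, y, h.symm⟩
  choose x y hxy using hV'
  have hv0 : V.rep ≠ 0 := V.rep_nonzero
  have hxy0 : ¬ (x 1 = 0 ∧ y 1 = 0) := by
    rintro ⟨h1, h2⟩
    apply hv0
    rw [hxy 1, h1, h2]; simp
  -- the lifted vertex `B₂*`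
  have hBst : B₂s.submodule = Submodule.span K {y 1 • b 1 - x 1 • w} := by
    obtain ⟨h1, h2⟩ := hB₂s
    rw [pt_le_iff, pspan_pair' (hrep V) hAst, Submodule.mem_span_pair] at h1
    rw [pt_le_iff, pspan_pair' hWs (hBs 1), Submodule.mem_span_pair] at h2
    obtain ⟨p, q, h1⟩ := h1
    obtain ⟨r, s, h2⟩ := h2
    rw [hxy 1] at h1
    have hqr : q = r := by
      have := congrArg φ' (h1.trans h2.symm)
      simpa [hφw, hφa, hφ'b] using this
    subst hqr
    have hpq : p * x 1 + q = 0 := by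
      by_contra hne
      have h3 : (p * x 1 + q) • a 1 = (s - p * y 1) • b 1 := by
        have := h1.trans h2.symm
        linear_combination (norm := module) this
      apply rep_ne_smul (hvert 1 1) ((p * x 1 + q)⁻¹ * (s - p * y 1))
      rw [ha, hb, ← smul_smul, ← h3, smul_smul, inv_mul_cancel₀ hne, one_smul]
    have hq : q = - (p * x 1) := by linear_combination hpq
    have hfin : B₂s.rep = p • (y 1 • b 1 - x 1 • w) := by
      rw [← h1, hq]; module
    have hp : p ≠ 0 := by
      rintro rfl
      apply B₂s.rep_nonzero
      rw [hfin, zero_smul]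
    exact sub_eq_of_smul hp hfin
  -- the lifted triangles
  have hAu : ∀ i, (Function.update A 1 A₂s i).submodule =
      Submodule.span K {(![a 0, a 1 + w, a 2] : Fin 3 → (Fin 4 → K)) i} := by
    intro i
    fin_cases i
    · simpa using hAs 0
    · simpa using hAst
    · simpa using hAs 2
  have hBu : ∀ i, (Function.update B 1 B₂s i).submodule =
      Submodule.span K {(![b 0, y 1 • b 1 - x 1 • w, b 2] : Fin 3 → (Fin 4 → K)) i} := by
    intro i
    fin_cases i
    · simpa using hBs 0
    · simpa using hBst
    · simpa using hBs 2
  have hPA : ∀ z, z ∈ pspan K (Set.range (Function.update A 1 A₂s)) ↔ α 1 z = φ' z := by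
    intro z
    rw [pspan_range' hAu, mem_span_three]
    constructor
    · rintro ⟨c0, c1, c2, rfl⟩
      simp [hφa, hαa, hαw, hφw]
    · intro h
      refine ⟨α 0 z, α 1 z, α 2 z, ?_⟩
      have := hαx z
      rw [← h] at this
      simp only [Matrix.cons_val]
      conv_lhs => rw [this]
      module
  have hPB : ∀ z, z ∈ pspan K (Set.range (Function.update B 1 B₂s)) ↔
      y 1 * φ' z + x 1 * β 1 z = 0 := by
    intro z
    rw [pspan_range' hBu, mem_span_three]
    constructor
    · rintro ⟨c0, c1, c2, rfl⟩
      simp [hφ'b, hβb, hβw, hφw]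
      ring
    · intro h
      obtain ⟨k, hk1, hk2⟩ : ∃ k, β 1 z = k * y 1 ∧ φ' z = - k * x 1 := by
        by_cases hx : x 1 = 0
        · have hy : y 1 ≠ 0 := fun hy => hxy0 ⟨hx, hy⟩
          refine ⟨β 1 z / y 1, by field_simp, ?_⟩
          rw [hx] at h ⊢
          simpa [hy] using h
        · refine ⟨- φ' z / x 1, ?_, by field_simp⟩
          field_simp
          linear_combination h
      refine ⟨β 0 z, k, β 2 z, ?_⟩
      have := hβx z
      rw [hk1, hk2] at this
      simp only [Matrix.cons_val]
      conv_lhs => rw [this]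
      module
  -- sides
  have hsd : ∀ i j : Fin 3, i ≠ j →
      Submodule.span K {a i, a j} ≠ Submodule.span K {b i, b j} := by
    intro i j hij
    have := hside i j i j hij hij
    rwa [pspan_pair' (hAs i) (hAs j), pspan_pair' (hBs i) (hBs j)] at this
  have haπ : ∀ i, a i ∈ π := fun i => by rw [hφπ, hφa]
  have hbπ : ∀ i, b i ∈ π := fun i => by rw [hφπ, hφ'b]
  have hA02 : ∀ z, z ∈ Submodule.span K {a 0, a 2} ↔ φ' z = 0 ∧ α 1 z = 0 := by
    intro z
    rw [Submodule.mem_span_pair]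
    constructor
    · rintro ⟨c, d, rfl⟩
      simp [hφa, hαa]
    · rintro ⟨h1, h2⟩
      refine ⟨α 0 z, α 2 z, ?_⟩
      have := hαx z
      rw [h1, h2] at this
      conv_rhs => rw [this]
      module
  have hB02 : ∀ z, z ∈ Submodule.span K {b 0, b 2} ↔ φ' z = 0 ∧ β 1 z = 0 := by
    intro z
    rw [Submodule.mem_span_pair]
    constructor
    · rintro ⟨c, d, rfl⟩
      simp [hφ'b, hβb]
    · rintro ⟨h1, h2⟩
      refine ⟨β 0 z, β 2 z, ?_⟩
      have := hβx z
      rw [h1, h2] at this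
      conv_rhs => rw [this]
      module
  have hind : ∀ (p q r s : Fin 4 → K), LinearIndependent K ![p, q] →
      p ∈ Submodule.span K {r, s} → q ∈ Submodule.span K {r, s} →
      Submodule.span K {p, q} = Submodule.span K {r, s} := by
    intro p q r s hli hp hq
    by_contra hne
    have hp0 : p ≠ 0 := hli.ne_zero 0
    obtain ⟨c, hc⟩ := inter_prop hne (x := q) (y := p) (Submodule.subset_span (by simp)) hq
      (Submodule.subset_span (by simp)) hp hp0
    rw [LinearIndependent.pair_iff' hp0] at hli
    exact hli c hc.symm
  have hlia : LinearIndependent K ![a 0, a 2] := by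
    rw [LinearIndependent.pair_iff]
    intro s t h
    constructor
    · simpa [hαa] using congrArg (α 0) h
    · simpa [hαa] using congrArg (α 2) h
  have hlib : LinearIndependent K ![b 0, b 2] := by
    rw [LinearIndependent.pair_iff]
    intro s t h
    constructor
    · simpa [hβb] using congrArg (β 0) h
    · simpa [hβb] using congrArg (β 2) h
  refine ⟨?_, ?_, ?_⟩
  · intro i
    by_cases hi : i = 1
    · subst hi
      simp only [Function.update_self]
      rw [pt_le_iff, pspan_pair' hAst hBst, Submodule.mem_span_pair]
      refine ⟨x 1, 1, ?_⟩
      rw [hxy 1]; module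
    · simpa [Function.update_of_ne hi] using hV i
  · rw [pspan_union']
    have hb' : ∃ z ∈ pspan K (Set.range (Function.update B 1 B₂s)), α 1 z - φ' z ≠ 0 := by
      by_contra! hcon
      have h0 : b 0 ∈ Submodule.span K {a 0, a 2} := by
        rw [hA02]
        have := hcon (b 0) (by rw [hPB]; simp [hφ'b, hβb])
        rw [hφ'b] at this
        exact ⟨hφ'b 0, by simpa using this⟩
      have h2 : b 2 ∈ Submodule.span K {a 0, a 2} := by
        rw [hA02]
        have := hcon (b 2) (by rw [hPB]; simp [hφ'b, hβb])
        rw [hφ'b] at this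
        exact ⟨hφ'b 2, by simpa using this⟩
      exact hsd 0 2 (by decide) (hind _ _ _ _ hlib h0 h2).symm
    obtain ⟨z, hz, hz0⟩ := hb'
    rw [eq_top_iff]
    intro u _
    rw [Submodule.mem_sup]
    refine ⟨u - ((α 1 u - φ' u) / (α 1 z - φ' z)) • z, ?_,
      ((α 1 u - φ' u) / (α 1 z - φ' z)) • z, Submodule.smul_mem _ _ hz, by simp⟩
    rw [hPA]
    simp only [map_sub, map_smul, smul_eq_mul]
    field_simp
    ring
  · let ψ : (Fin 4 → K) →ₗ[K] K := y 1 • α 1 + x 1 • β 1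
    have hψ : ∀ z, ψ z = y 1 * α 1 z + x 1 * β 1 z := fun z => by simp [ψ]
    have hl : ∀ z, z ∈ LinearMap.ker (φ'.prod ψ) ↔
        φ' z = 0 ∧ y 1 * α 1 z + x 1 * β 1 z = 0 := by
      intro z
      rw [LinearMap.mem_ker, LinearMap.prod_apply, ← hψ]
      simp
    refine ⟨LinearMap.ker (φ'.prod ψ), ?_, ?_, ?_, ?_, ?_⟩
    · have hz : ∃ z, φ' z = 0 ∧ ψ z ≠ 0 := by
        by_contra! hcon
        simp only [hψ] at hcon
        by_cases hx : x 1 = 0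
        · have hy : y 1 ≠ 0 := fun hy => hxy0 ⟨hx, hy⟩
          have := hcon (a 1) (hφa 1)
          rw [hx, hαa] at this
          simp [hy] at this
        · have h0 := hcon (a 0) (hφa 0)
          have h2 := hcon (a 2) (hφa 2)
          rw [hαa] at h0 h2
          simp [hx] at h0 h2
          exact hsd 0 2 (by decide) (hind _ _ _ _ hlia ((hB02 _).2 ⟨hφa 0, h0⟩)
            ((hB02 _).2 ⟨hφa 2, h2⟩))
      obtain ⟨z, hz1, hz2⟩ := hz
      have hsurj : LinearMap.range (φ'.prod ψ) = ⊤ := by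
        rw [LinearMap.range_eq_top]
        rintro ⟨c, d⟩
        refine ⟨c • w + ((d - c * ψ w) / ψ z) • z, ?_⟩
        simp only [LinearMap.prod_apply, Function.prod_apply, map_add, map_smul, hφw, hz1,
          smul_eq_mul, Prod.smul_mk, Prod.mk_add_mk, Prod.mk.injEq]
        constructor
        · ring
        · field_simp; ring
      have := LinearMap.finrank_range_add_finrank_ker (φ'.prod ψ)
      rw [hsurj, finrank_top] at this
      simp at this
      omega
    · intro z hz
      rw [hφπ]; exact ((hl z).1 hz).1
    · -- sides through the vertex with index `1`
      have key : ∀ i : Fin 3, i ≠ 1 → ∀ z, z ∈ Submodule.span K {a i, a 1} →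
          z ∈ Submodule.span K {b i, b 1} → z ∈ LinearMap.ker (φ'.prod ψ) := by
        intro i hi z hz hz'
        have hp0 : x i • a i - x 1 • a 1 = y 1 • b 1 - y i • b i := by
          have := (hxy i).symm.trans (hxy 1)
          linear_combination (norm := module) this
        have hne : x i • a i - x 1 • a 1 ≠ 0 := by
          intro h
          have h1 : x 1 = 0 := by
            simpa [hαa, hi.symm] using congrArg (α 1) h
          have h2 : y 1 = 0 := by
            simpa [hβb, hi.symm] using congrArg (β 1) (hp0.symm.trans h)
          exact hxy0 ⟨h1, h2⟩
        obtain ⟨c, rfl⟩ := inter_prop (hsd i 1 hi) hz hz'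
          (y := x i • a i - x 1 • a 1)
          (Submodule.mem_span_pair.2 ⟨x i, - x 1, by module⟩)
          (by rw [hp0]; exact Submodule.mem_span_pair.2 ⟨- y i, y 1, by module⟩) hne
        apply Submodule.smul_mem
        rw [hl]
        have e1 : α 1 (x i • a i - x 1 • a 1) = - x 1 := by simp [hαa, hi.symm]
        have e2 : β 1 (x i • a i - x 1 • a 1) = y 1 := by rw [hp0]; simp [hβb, hi.symm]
        rw [e1, e2]
        exact ⟨by simp [hφa], by ring⟩
      have key02 : ∀ z, z ∈ Submodule.span K {a 0, a 2} →
          z ∈ Submodule.span K {b 0, b 2} → z ∈ LinearMap.ker (φ'.prod ψ) := by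
        intro z hz hz'
        rw [hA02] at hz
        rw [hB02] at hz'
        rw [hl, hz.2, hz'.2]
        exact ⟨hz.1, by ring⟩
      intro i j hij P hP hP'
      rw [pt_le_iff, pspan_pair' (hAs i) (hAs j)] at hP
      rw [pt_le_iff, pspan_pair' (hBs i) (hBs j)] at hP'
      rw [pt_le_iff]
      by_cases hj : j = 1
      · subst hj
        exact key i hij _ hP hP'
      · by_cases hi : i = 1
        · subst hi
          rw [Set.pair_comm] at hP hP'
          exact key j hj _ hP hP'
        · have : (i = 0 ∧ j = 2) ∨ (i = 2 ∧ j = 0) := by omega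
          rcases this with ⟨rfl, rfl⟩ | ⟨rfl, rfl⟩
          · exact key02 _ hP hP'
          · rw [Set.pair_comm] at hP hP'
            exact key02 _ hP hP'
    · intro Q hQ Q' hQ' hQπ
      rw [pt_le_iff, Submodule.mem_inf, hPA, hPB] at hQ
      obtain ⟨q1, q2⟩ := hQ
      rw [pt_le_iff, hφπ] at hQπ
      rw [pt_le_iff, pspan_pair' hWs (hrep Q), Submodule.mem_span_pair] at hQ'
      obtain ⟨m, n, h⟩ := hQ'
      rw [pt_le_iff, hl]
      refine ⟨hQπ, ?_⟩
      rw [← h]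
      simp only [map_add, map_smul, hαw, hβw, smul_eq_mul, q1]
      linear_combination n * q2
    · intro Q' hQ'
      rw [pt_le_iff, hl] at hQ'
      obtain ⟨h1, h2⟩ := hQ'
      have hne : Q'.rep + α 1 Q'.rep • w ≠ 0 := by
        intro h
        have h3 : α 1 Q'.rep = 0 := by simpa [h1, hφw] using congrArg φ' h
        rw [h3, zero_smul, add_zero] at h
        exact Q'.rep_nonzero h
      have hs : (Projectivization.mk K _ hne).submodule =
          Submodule.span K {Q'.rep + α 1 Q'.rep • w} := Projectivization.submodule_mk _ _
      refine ⟨Projectivization.mk K _ hne, ?_, ?_⟩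
      · rw [hs, Submodule.span_singleton_le_iff_mem, Submodule.mem_inf, hPA, hPB]
        simp only [map_add, map_smul, hαw, hβw, hφw, h1, smul_eq_mul]
        exact ⟨by ring, by linear_combination h2⟩
      · rw [pt_le_iff, pspan_pair' hWs hs, Submodule.mem_span_pair]
        exact ⟨- α 1 Q'.rep, 1, by module⟩
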